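/- The division subring k_q(f,g) of D generated over k by f and g equals the fixed ring D^σ = {r ∈ D : σ(r) = r}, and consequently D^σ is isomorphic to D = k_q(x,y) as a k-algebra (for the same q). -/

import Mathlib

/-- `D`, together with the distinguished nonzero elements `x`, `y` satisfying
`x * y = q • (y * x)`, is the `q`-division ring `k_q(x,y)`: the Ore division ring of fractions
of the quantum plane `k_q[x,y]`.  The quantum plane sits inside `D` as the `k`-subalgebra
generated by `x` and `y`; linear independence of the monomials `yⁱxʲ` says that this subalgebra
really is the quantum plane, and `exists_frac` says that `D` is its ring of (left) fractions. -/
structure IsQDivisionRing (k : Type*) [Field k] (D : Type*) [DivisionRing D] [Algebra k D]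
    (q : k) (x y : D) : Prop where
  x_ne_zero : x ≠ 0
  y_ne_zero : y ≠ 0
  rel : x * y = algebraMap k D q * (y * x)
  monomials_linearIndependent :
    LinearIndependent k fun p : ℕ × ℕ => y ^ p.1 * x ^ p.2
  exists_frac : ∀ d : D, ∃ s t : D, s ∈ Algebra.adjoin k ({x, y} : Set D) ∧
    t ∈ Algebra.adjoin k ({x, y} : Set D) ∧ t ≠ 0 ∧ d = t⁻¹ * s

/-- `MemDivisionClosure k s d` says that `d` lies in the division subring of `D`
generated over `k` by the set `s`. -/
inductive MemDivisionClosure (k : Type*) [Field k] {D : Type*} [DivisionRing D] [Algebra k D]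
    (s : Set D) : D → Prop
  | mem {a : D} : a ∈ s → MemDivisionClosure k s a
  | scalar (c : k) : MemDivisionClosure k s (algebraMap k D c)
  | add {a b : D} : MemDivisionClosure k s a → MemDivisionClosure k s b →
      MemDivisionClosure k s (a + b)
  | neg {a : D} : MemDivisionClosure k s a → MemDivisionClosure k s (-a)
  | mul {a b : D} : MemDivisionClosure k s a → MemDivisionClosure k s b →
      MemDivisionClosure k s (a * b)
  | inv {a : D} : MemDivisionClosure k s a → MemDivisionClosure k s a⁻¹

section Torus

/-- The relations among the eigenvectors `a`, `a'`, `b`, `b'` and the invariants `t₁`, `t₂` of a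
cyclic permutation `x ↦ y ↦ z ↦ x` of generators of a quantum torus with `x * y * z` scalar. -/
structure EigenRelations {k S : Type*} [Field k] [Ring S] [Algebra k S] (h p w v : k)
    (a a' b b' t₁ t₂ : S) : Prop where
  a_mul_t₁ : t₁ * a = a * t₁ - ((w - v) * (h - p)) • b
  a'_mul_t₁ : t₁ * a' = a' * t₁ - ((v - w) * (h - p)) • b'
  a'_mul_a' : a' * a' = a * t₁ + ((1 - w) * h + (1 - v) * p) • b
  a_mul_a : a * a = a' * t₁ + ((1 - v) * h + (1 - w) * p) • b'
  t₁_mul_b : t₁ * b + a * t₂ + a' * b' = 0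
  t₁_mul_b' : t₁ * b' + a' * t₂ + a * b = 0
  t₁_mul_t₂ : t₁ * t₂ + a * b' + a' * b = 9
  a_mul_a' : a * a' = t₁ * t₁ - ((1 - v) * h + (1 - w) * p) • t₂
  a'_mul_a : a' * a = t₁ * t₁ - ((1 - w) * h + (1 - v) * p) • t₂

/-- `x + w y + v z`, where `z = h Y X`. -/
def cyclicEigenvector {k S : Type*} [Field k] [Ring S] [Algebra k S] (h w v : k) (x y X Y : S) :
    S :=
  x + w • y + v • h • (Y * X)

variable {k S : Type*} [Field k] [Ring S] [Algebra k S]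

/-- Elements `x`, `y` with two-sided inverses `X`, `Y` satisfying `x * y = h ^ 2 • (y * x)`,
where `h` has inverse `p`, in the form of rules that move `x` and `X` to the right. -/
structure QTorusRules (h p : k) (x X y Y : S) : Prop where
  hp : h * p = 1
  xX : x * X = 1
  Xx : X * x = 1
  yY : y * Y = 1
  Yy : Y * y = 1
  xy : x * y = h ^ 2 • (y * x)
  xY : x * Y = p ^ 2 • (Y * x)
  Xy : X * y = p ^ 2 • (y * X)
  XY : X * Y = h ^ 2 • (Y * X)

namespace QTorusRules

variable {h p : k} {x X y Y : S} (H : QTorusRules h p x X y Y) (r : S)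
include H

theorem yY_assoc : y * (Y * r) = r := by rw [← mul_assoc, H.yY, one_mul]
theorem Yy_assoc : Y * (y * r) = r := by rw [← mul_assoc, H.Yy, one_mul]
theorem xy_assoc : x * (y * r) = h ^ 2 • (y * (x * r)) := by
  rw [← mul_assoc, H.xy, smul_mul_assoc, mul_assoc]
theorem xY_assoc : x * (Y * r) = p ^ 2 • (Y * (x * r)) := by
  rw [← mul_assoc, H.xY, smul_mul_assoc, mul_assoc]
theorem Xy_assoc : X * (y * r) = p ^ 2 • (y * (X * r)) := by
  rw [← mul_assoc, H.Xy, smul_mul_assoc, mul_assoc]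
theorem XY_assoc : X * (Y * r) = h ^ 2 • (Y * (X * r)) := by
  rw [← mul_assoc, H.XY, smul_mul_assoc, mul_assoc]

theorem eigenRelations {w v : k} (hwv : w * v = 1) (hs : w + v + 1 = 0) :
    EigenRelations h p w v (cyclicEigenvector h w v x y X Y) (cyclicEigenvector h v w x y X Y)
      (cyclicEigenvector h w v X Y x y) (cyclicEigenvector h v w X Y x y)
      (cyclicEigenvector h 1 1 x y X Y) (cyclicEigenvector h 1 1 X Y x y) := by
  have hp := H.hp
  have h9 : (9 : S) = (9 : k) • (1 : S) := by rw [← Algebra.algebraMap_eq_smul_one, map_ofNat]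
  constructor <;>
  · simp only [cyclicEigenvector, h9, mul_add, add_mul, mul_smul_comm, smul_mul_assoc, mul_assoc,
      H.xX, H.Xx, H.yY, H.Yy, H.xy, H.xY, H.Xy, H.XY, H.yY_assoc, H.Yy_assoc, H.xy_assoc,
      H.xY_assoc, H.Xy_assoc, H.XY_assoc, mul_one]
    match_scalars <;> grind

theorem eigenvector_mul_sub {w v : k} (hwv : w * v = 1) (hs : w + v + 1 = 0) :
    cyclicEigenvector h w v x y X Y * cyclicEigenvector h 1 1 X Y x y -
      v • (cyclicEigenvector h 1 1 x y X Y * cyclicEigenvector h w v X Y x y) =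
    (h * (w - v)) • (p • (y * X) + (w * h ^ 2) • (Y * Y * X) + (v * h ^ 2) • (y * x * x)) := by
  have hp := H.hp
  simp only [cyclicEigenvector, mul_add, add_mul, mul_smul_comm, smul_mul_assoc, mul_assoc,
    H.xX, H.Xx, H.yY, H.Yy, H.xY, H.XY, H.xy_assoc, H.Xy_assoc, mul_one]
  match_scalars <;> grind

end QTorusRules

namespace EigenRelations

variable {k D : Type*} [Field k] [DivisionRing D] [Algebra k D] {h p w v : k}
  {a a' b b' t₁ t₂ : D}

theorem swap (H : EigenRelations h p w v a a' b b' t₁ t₂) :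
    EigenRelations h p v w a' a b' b t₁ t₂ where
  a_mul_t₁ := H.a'_mul_t₁
  a'_mul_t₁ := H.a_mul_t₁
  a'_mul_a' := H.a_mul_a
  a_mul_a := H.a'_mul_a'
  t₁_mul_b := H.t₁_mul_b'
  t₁_mul_b' := H.t₁_mul_b
  t₁_mul_t₂ := by rw [← H.t₁_mul_t₂]; abel
  a_mul_a' := H.a'_mul_a
  a'_mul_a := H.a_mul_a'

/-- The invariants `t₁`, `t₂` and the ratios `g = a⁻¹ b`, `g' = a'⁻¹ b'` satisfy a relation that is
linear in `t₁` and `t₂`. -/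
theorem t₂_eq (H : EigenRelations h p w v a a' b b' t₁ t₂) (ha : a ≠ 0) (ha' : a' ≠ 0)
    {g g' : D} (hg : g = a⁻¹ * b) (hg' : g' = a'⁻¹ * b') :
    t₂ = -(t₁ * (g + g')) + (((w - v) * (h - p)) • (g * g) -
      ((1 - w) * h + (1 - v) * p) • (g * g')) := by
  have hb : b = a * g := by rw [hg, mul_inv_cancel_left₀ ha]
  have hb' : b' = a' * g' := by rw [hg', mul_inv_cancel_left₀ ha']
  have e := H.t₁_mul_b
  have e₁ := H.a_mul_t₁
  have e₂ := H.a'_mul_a'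
  rw [hb] at e₁ e₂
  rw [hb, hb', ← mul_assoc, ← mul_assoc, e₁, e₂] at e
  have e₃ : a * (t₁ * g - ((w - v) * (h - p)) • (g * g) + t₂ +
      (t₁ * g' + ((1 - w) * h + (1 - v) * p) • (g * g'))) = 0 := by
    rw [← e]
    simp only [mul_add, mul_sub, add_mul, sub_mul, mul_smul_comm, smul_mul_assoc, mul_assoc]
  have e₄ := (mul_eq_zero.mp e₃).resolve_left ha
  rw [mul_add]
  linear_combination (norm := module) e₄

theorem qcommute (H : EigenRelations h p w v a a' b b' t₁ t₂) (ha : a ≠ 0) (ha' : a' ≠ 0)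
    (h3 : (3 : k) ≠ 0) (hp : h * p = 1) (hwv : w * v = 1) (hs : w + v + 1 = 0)
    {g g' : D} (hg : g = a⁻¹ * b) (hg' : g' = a'⁻¹ * b') :
    (g' - w • g) * (g' - v • g) = h ^ 2 • ((g' - v • g) * (g' - w • g)) := by
  have e₁ := H.t₂_eq ha ha' hg hg'
  have e₂ := H.swap.t₂_eq ha' ha hg' hg
  have e : ((1 - w) * h + (1 - v) * p) • (g * g') - ((1 - v) * h + (1 - w) * p) • (g' * g) -
      ((w - v) * (h - p)) • (g * g + g' * g') = 0 := by
    rw [add_comm g'] at e₂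
    linear_combination (norm := module) e₁ - e₂
  have hi : 3 * (3 : k)⁻¹ = 1 := mul_inv_cancel₀ h3
  rw [← sub_eq_zero, ← smul_zero (h * v * (1 - v) * 3⁻¹), ← e]
  simp only [mul_sub, sub_mul, mul_smul_comm, smul_mul_assoc]
  match_scalars <;> grind

theorem t₁_mul (H : EigenRelations h p w v a a' b b' t₁ t₂) (ha : a ≠ 0) (ha' : a' ≠ 0)
    (h3 : (3 : k) ≠ 0) (hp : h * p = 1) (hwv : w * v = 1) (hs : w + v + 1 = 0)
    {g g' : D} (hg : g = a⁻¹ * b) (hg' : g' = a'⁻¹ * b') :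
    t₁ * ((g' - w • g) * (g' - v • g)) = (3⁻¹ * h) • (9 + g *
      (((w - v) * (h - p)) • g - ((1 - w) * h + (1 - v) * p) • g') *
      (((1 - v) * h + (1 - w) * p) • g' + ((1 - w) * h + (1 - v) * p) • g)) := by
  have hi : 3 * (3 : k)⁻¹ = 1 := mul_inv_cancel₀ h3
  have hb : b = a * g := by rw [hg, mul_inv_cancel_left₀ ha]
  have hb' : b' = a' * g' := by rw [hg', mul_inv_cancel_left₀ ha']
  have e₁ := H.t₂_eq ha ha' hg hg'
  have e₂ := H.swap.t₂_eq ha' ha hg' hg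
  rw [add_comm g'] at e₂
  have e := H.t₁_mul_t₂
  rw [hb, hb', ← mul_assoc, ← mul_assoc, H.a_mul_a', H.a'_mul_a] at e
  have e₃ : t₁ * (((1 - w) * h + (1 - v) * p) • (g * g') -
      ((1 - v) * h + (1 - w) * p) • (g' * g) - ((w - v) * (h - p)) • (g * g + g' * g')) = 0 := by
    convert mul_zero t₁
    linear_combination (norm := module) e₁ - e₂
  rw [← e]
  clear e
  subst e₁
  rw [← sub_eq_zero, ← smul_zero (-(3⁻¹ * h * w)), ← e₃]
  simp only [mul_sub, sub_mul, mul_add, add_mul, mul_neg, neg_mul, mul_smul_comm, smul_mul_assoc,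
    mul_assoc]
  match_scalars <;> grind

theorem sub_mul_eq (H : EigenRelations h p w v a a' b b' t₁ t₂) (ha : a ≠ 0) (ha' : a' ≠ 0)
    (h3 : (3 : k) ≠ 0) (hp : h * p = 1) (hwv : w * v = 1) (hs : w + v + 1 = 0)
    {f g g' : D} (hg : g = a⁻¹ * b) (hg' : g' = a'⁻¹ * b') (hg0 : g ≠ 0)
    (hf : f = t₂ - v • (t₁ * g) + ((v - w) * p) • (v • (g * g) + h ^ 2 • g⁻¹)) :
    f * (g' - v • g) = ((v - w) * h) • ((h ^ 2 • (g * g) + g⁻¹) * (g' - w • g)) := by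
  have hi : 3 * (3 : k)⁻¹ = 1 := mul_inv_cancel₀ h3
  have e₁ := H.t₂_eq ha ha' hg hg'
  have e₂ := H.t₁_mul ha ha' h3 hp hwv hs hg hg'
  have e₃ := H.qcommute ha ha' h3 hp hwv hs hg hg'
  have e₄ : g⁻¹ * (g' - v • g) = g⁻¹ * (g' - w • g) - (v - w) • (1 : D) := by
    simp only [mul_sub, mul_smul_comm, inv_mul_cancel₀ hg0]
    module
  set m := g' - w • g with hm
  set n := g' - v • g with hn
  set K := ((w - v) * (h - p)) • g - ((1 - w) * h + (1 - v) * p) • g' with hK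
  set L := ((1 - v) * h + (1 - w) * p) • g' + ((1 - w) * h + (1 - v) * p) • g with hL
  have hgm : g = ((w - v) * 3⁻¹) • (m - n) := by
    rw [hm, hn]
    match_scalars <;> grind
  have hK' : K = ((w - 1) * h) • m + ((v - 1) * p) • n := by
    rw [hK, hm, hn]
    match_scalars <;> grind
  have hL' : L = ((1 - v) * h) • m + ((1 - w) * p) • n := by
    rw [hL, hm, hn]
    match_scalars <;> grind
  have e₅ : K * (n - (3⁻¹ * h) • L) + ((v - w) * p * v) • (g * n) =
      ((v - w) * h ^ 3) • (g * m) := by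
    rw [hK', hL', hgm]
    simp only [mul_sub, sub_mul, mul_add, add_mul, mul_smul_comm, smul_mul_assoc, e₃]
    match_scalars <;> grind
  have e₆ : f = -(t₁ * m) + g * K + ((v - w) * p) • (v • (g * g) + h ^ 2 • g⁻¹) := by
    rw [hf, e₁, hm, hK]
    simp only [mul_sub, mul_add, mul_smul_comm]
    match_scalars <;> grind
  have h9 : (9 : D) = (9 : k) • (1 : D) := by rw [← Algebra.algebraMap_eq_smul_one, map_ofNat]
  have e₇ := congrArg (g * ·) e₅
  simp only [mul_sub, mul_add, mul_smul_comm, ← mul_assoc] at e₇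
  rw [← mul_assoc] at e₂
  rw [e₆]
  simp only [add_mul, neg_mul, smul_mul_assoc, e₂, e₄, h9, smul_sub, smul_add]
  rw [← sub_eq_zero] at e₇ ⊢
  rw [← e₇]
  match_scalars <;> grind

end EigenRelations

end Torus

section QuantumPlane

variable {k S : Type*} [Field k] [Ring S] [Algebra k S] {q : k} {x y : S}

theorem pow_mul_pow_of_qcommute (hxy : x * y = q • (y * x)) (i j : ℕ) :
    x ^ j * y ^ i = q ^ (i * j) • (y ^ i * x ^ j) := by
  have h1 (i : ℕ) : x * y ^ i = q ^ i • (y ^ i * x) := by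
    induction i with
    | zero => simp
    | succ i ih =>
      rw [pow_succ, ← mul_assoc, ih, smul_mul_assoc, mul_assoc, hxy, mul_smul_comm, smul_smul,
        ← pow_succ, mul_assoc]
  induction j with
  | zero => simp
  | succ j ih =>
    rw [pow_succ', mul_assoc, ih, mul_smul_comm, ← mul_assoc, h1, smul_mul_assoc, smul_smul,
      ← pow_add, mul_assoc, ← pow_succ', mul_add_one]

theorem monomial_mul_monomial (hxy : x * y = q • (y * x)) (s t : ℕ × ℕ) :
    y ^ s.1 * x ^ s.2 * (y ^ t.1 * x ^ t.2) =
      q ^ (t.1 * s.2) • (y ^ (s + t).1 * x ^ (s + t).2) := by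
  rw [mul_assoc, ← mul_assoc (x ^ s.2), pow_mul_pow_of_qcommute hxy, smul_mul_assoc,
    mul_smul_comm, mul_assoc, ← pow_add, ← mul_assoc, ← pow_add, Prod.fst_add, Prod.snd_add]

theorem adjoin_le_span_monomials (hxy : x * y = q • (y * x)) :
    Subalgebra.toSubmodule (Algebra.adjoin k ({x, y} : Set S)) ≤
      Submodule.span k (Set.range fun s : ℕ × ℕ => y ^ s.1 * x ^ s.2) := by
  set M := Submodule.span k (Set.range fun s : ℕ × ℕ => y ^ s.1 * x ^ s.2)
  have hmon (s : ℕ × ℕ) : y ^ s.1 * x ^ s.2 ∈ M := Submodule.subset_span ⟨s, rfl⟩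
  have hmul : M * M ≤ M := by
    rw [Submodule.span_mul_span, Submodule.span_le]
    rintro _ ⟨_, ⟨s, rfl⟩, _, ⟨t, rfl⟩, rfl⟩
    dsimp only
    rw [monomial_mul_monomial hxy]
    exact M.smul_mem _ (hmon _)
  intro r hr
  induction hr using Algebra.adjoin_induction with
  | mem r hr =>
    obtain rfl | rfl := hr
    · simpa using hmon (0, 1)
    · simpa using hmon (1, 0)
  | algebraMap c =>
    rw [Algebra.algebraMap_eq_smul_one]
    exact M.smul_mem _ (by simpa using hmon (0, 0))
  | add r s _ _ hr hs => exact M.add_mem hr hs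
  | mul r s _ _ hr hs => exact hmul (Submodule.mul_mem_mul hr hs)

end QuantumPlane

namespace IsQDivisionRing

variable {k D : Type*} [Field k] [DivisionRing D] [Algebra k D] {q : k} {x y : D}

theorem qcommute (hD : IsQDivisionRing k D q x y) : x * y = q • (y * x) := by
  rw [hD.rel, Algebra.smul_def]

theorem exists_ore (hD : IsQDivisionRing k D q x y) (s : D) {t : D} (ht : t ≠ 0) :
    ∃ s' t' : D, s' ∈ Algebra.adjoin k ({x, y} : Set D) ∧
      t' ∈ Algebra.adjoin k ({x, y} : Set D) ∧ t' ≠ 0 ∧ t' * s = s' * t := by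
  obtain ⟨s', t', hs', ht', ht'0, e⟩ := hD.exists_frac (s * t⁻¹)
  refine ⟨s', t', hs', ht', ht'0, ?_⟩
  rw [eq_inv_mul_iff_mul_eq₀ ht'0] at e
  rw [← e, mul_assoc, inv_mul_cancel_right₀ ht]

end IsQDivisionRing

section Degree

variable {k D : Type*} [Field k] [DivisionRing D] [Algebra k D] {q : k} {x y : D}

/-- The exponent `(j, i)` of the monomial `y ^ i * x ^ j`, ordered lexicographically. -/
def lexExponent (s : ℕ × ℕ) : ℤ ×ₗ ℤ := toLex ((s.2 : ℤ), (s.1 : ℤ))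

theorem lexExponent_add (s t : ℕ × ℕ) :
    lexExponent (s + t) = lexExponent s + lexExponent t := by
  simp [lexExponent, ← toLex_add]

theorem lexExponent_injective : Function.Injective lexExponent := by
  rintro ⟨i, j⟩ ⟨i', j'⟩ e
  simpa [lexExponent, and_comm] using e

variable (k x y) in
/-- The span of the monomials with exponent below `γ`. -/
def lowerTerms (γ : ℤ ×ₗ ℤ) : Submodule k D :=
  Submodule.span k ((fun s : ℕ × ℕ => y ^ s.1 * x ^ s.2) '' {s | lexExponent s < γ})

variable (k x y) in
/-- `r` is a polynomial in `x`, `y` whose leading exponent is `s`. -/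
def HasLeadingExponent (r : D) (s : ℕ × ℕ) : Prop :=
  ∃ c : k, c ≠ 0 ∧ r - c • (y ^ s.1 * x ^ s.2) ∈ lowerTerms k x y (lexExponent s)

variable (k x y) in
/-- `d` is a fraction of polynomials in `x`, `y` whose leading exponents differ by `γ`. -/
def HasDegree (d : D) (γ : ℤ ×ₗ ℤ) : Prop :=
  ∃ (s t : D) (m n : ℕ × ℕ), s ∈ Algebra.adjoin k ({x, y} : Set D) ∧
    t ∈ Algebra.adjoin k ({x, y} : Set D) ∧ HasLeadingExponent k x y s m ∧
    HasLeadingExponent k x y t n ∧ t * d = s ∧ γ + lexExponent n = lexExponent m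

theorem lowerTerms_mono {γ δ : ℤ ×ₗ ℤ} (h : γ ≤ δ) : lowerTerms k x y γ ≤ lowerTerms k x y δ :=
  Submodule.span_mono (Set.image_mono fun _ hs => lt_of_lt_of_le hs h)

theorem monomial_mem_lowerTerms {s : ℕ × ℕ} {γ : ℤ ×ₗ ℤ} (h : lexExponent s < γ) :
    y ^ s.1 * x ^ s.2 ∈ lowerTerms k x y γ :=
  Submodule.subset_span ⟨s, h, rfl⟩

theorem lowerTerms_mul (hxy : x * y = q • (y * x)) {γ δ ε : ℤ ×ₗ ℤ}
    (h : ∀ s t : ℕ × ℕ, lexExponent s < γ → lexExponent t < δ → lexExponent s + lexExponent t < ε)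
    {r r' : D} (hr : r ∈ lowerTerms k x y γ) (hr' : r' ∈ lowerTerms k x y δ) :
    r * r' ∈ lowerTerms k x y ε := by
  have hle : lowerTerms k x y γ * lowerTerms k x y δ ≤ lowerTerms k x y ε := by
    rw [lowerTerms, lowerTerms, Submodule.span_mul_span, Submodule.span_le]
    rintro _ ⟨_, ⟨s, hs, rfl⟩, _, ⟨t, ht, rfl⟩, rfl⟩
    dsimp only
    rw [monomial_mul_monomial hxy]
    refine Submodule.smul_mem _ _ (monomial_mem_lowerTerms ?_)
    rw [lexExponent_add]
    exact h s t hs ht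
  exact hle (Submodule.mul_mem_mul hr hr')

theorem monomial_mul_mem_lowerTerms (hxy : x * y = q • (y * x)) (s : ℕ × ℕ) {γ : ℤ ×ₗ ℤ} {r : D}
    (hr : r ∈ lowerTerms k x y γ) :
    y ^ s.1 * x ^ s.2 * r ∈ lowerTerms k x y (lexExponent s + γ) := by
  have hle : lowerTerms k x y γ ≤ (lowerTerms k x y (lexExponent s + γ)).comap
      (LinearMap.mulLeft k (y ^ s.1 * x ^ s.2)) := by
    rw [lowerTerms, Submodule.span_le]
    rintro _ ⟨t, ht, rfl⟩
    simp only [SetLike.mem_coe, Submodule.mem_comap, LinearMap.mulLeft_apply]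
    rw [monomial_mul_monomial hxy]
    refine Submodule.smul_mem _ _ (monomial_mem_lowerTerms ?_)
    rw [lexExponent_add]
    exact add_lt_add_right ht _
  exact hle hr

theorem mul_monomial_mem_lowerTerms (hxy : x * y = q • (y * x)) (s : ℕ × ℕ) {γ : ℤ ×ₗ ℤ} {r : D}
    (hr : r ∈ lowerTerms k x y γ) :
    r * (y ^ s.1 * x ^ s.2) ∈ lowerTerms k x y (γ + lexExponent s) := by
  have hle : lowerTerms k x y γ ≤ (lowerTerms k x y (γ + lexExponent s)).comap
      (LinearMap.mulRight k (y ^ s.1 * x ^ s.2)) := by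
    rw [lowerTerms, Submodule.span_le]
    rintro _ ⟨t, ht, rfl⟩
    simp only [SetLike.mem_coe, Submodule.mem_comap, LinearMap.mulRight_apply]
    rw [monomial_mul_monomial hxy]
    refine Submodule.smul_mem _ _ (monomial_mem_lowerTerms ?_)
    rw [lexExponent_add]
    exact add_lt_add_left ht _
  exact hle hr

namespace HasLeadingExponent

theorem mul (hq : q ≠ 0) (hxy : x * y = q • (y * x)) {r r' : D} {s s' : ℕ × ℕ}
    (h : HasLeadingExponent k x y r s) (h' : HasLeadingExponent k x y r' s') :
    HasLeadingExponent k x y (r * r') (s + s') := by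
  obtain ⟨c, hc, hr⟩ := h
  obtain ⟨c', hc', hr'⟩ := h'
  refine ⟨c * c' * q ^ (s'.1 * s.2), mul_ne_zero (mul_ne_zero hc hc') (pow_ne_zero _ hq), ?_⟩
  rw [lexExponent_add]
  have e₁ := Submodule.smul_mem _ c (monomial_mul_mem_lowerTerms hxy s hr')
  have e₂ := Submodule.smul_mem _ c' (mul_monomial_mem_lowerTerms hxy s' hr)
  have e₃ := lowerTerms_mul (ε := lexExponent s + lexExponent s') hxy
    (fun _ _ => add_lt_add) hr hr'
  convert add_mem (add_mem e₁ e₂) e₃ using 1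
  rw [mul_smul, ← monomial_mul_monomial hxy]
  simp only [mul_sub, sub_mul, mul_smul_comm, smul_mul_assoc]
  module

theorem mem_lowerTerms {r : D} {s : ℕ × ℕ} (h : HasLeadingExponent k x y r s) {γ : ℤ ×ₗ ℤ}
    (hs : lexExponent s < γ) : r ∈ lowerTerms k x y γ := by
  obtain ⟨c, -, hr⟩ := h
  rw [← sub_add_cancel r]
  exact add_mem (lowerTerms_mono hs.le hr)
    (Submodule.smul_mem _ _ (monomial_mem_lowerTerms hs))

theorem add_lower {r r' : D} {s : ℕ × ℕ} (h : HasLeadingExponent k x y r s)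
    (h' : r' ∈ lowerTerms k x y (lexExponent s)) : HasLeadingExponent k x y (r + r') s := by
  obtain ⟨c, hc, hr⟩ := h
  exact ⟨c, hc, by rw [add_sub_right_comm]; exact add_mem hr h'⟩

theorem notMem_lowerTerms (hD : IsQDivisionRing k D q x y) {r : D} {s : ℕ × ℕ}
    (h : HasLeadingExponent k x y r s) : r ∉ lowerTerms k x y (lexExponent s) := by
  obtain ⟨c, hc, hr⟩ := h
  intro hr'
  have hmem := (Submodule.smul_mem_iff _ hc).mp ((Submodule.sub_mem_iff_right _ hr').mp hr)
  exact hD.monomials_linearIndependent.notMem_span_image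
    (s := {t | lexExponent t < lexExponent s}) (x := s) (by simp) hmem

theorem ne_zero (hD : IsQDivisionRing k D q x y) {r : D} {s : ℕ × ℕ}
    (h : HasLeadingExponent k x y r s) : r ≠ 0 := fun h0 =>
  h.notMem_lowerTerms hD (h0 ▸ zero_mem _)

theorem unique (hD : IsQDivisionRing k D q x y) {r : D} {s t : ℕ × ℕ}
    (hs : HasLeadingExponent k x y r s) (ht : HasLeadingExponent k x y r t) :
    lexExponent s = lexExponent t := by
  rcases lt_trichotomy (lexExponent s) (lexExponent t) with h | h | h
  · exact absurd (hs.mem_lowerTerms h) (ht.notMem_lowerTerms hD)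
  · exact h
  · exact absurd (ht.mem_lowerTerms h) (hs.notMem_lowerTerms hD)

variable (k x y) in
theorem monomial (s : ℕ × ℕ) : HasLeadingExponent k x y (y ^ s.1 * x ^ s.2) s :=
  ⟨1, one_ne_zero, by simp⟩

theorem exists_of_mem_adjoin (hD : IsQDivisionRing k D q x y) {r : D}
    (hr : r ∈ Algebra.adjoin k ({x, y} : Set D)) (h0 : r ≠ 0) :
    ∃ s, HasLeadingExponent k x y r s := by
  obtain ⟨c, rfl⟩ := Finsupp.mem_span_range_iff_exists_finsupp.mp
    (adjoin_le_span_monomials hD.qcommute hr)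
  have hc : c.support.Nonempty := by
    rw [Finsupp.support_nonempty_iff]
    rintro rfl
    simp at h0
  obtain ⟨s, hs, hmax⟩ := Finset.exists_max_image c.support lexExponent hc
  refine ⟨s, c s, Finsupp.mem_support_iff.mp hs, ?_⟩
  rw [Finsupp.sum, ← Finset.add_sum_erase _ _ hs, add_sub_cancel_left]
  refine sum_mem fun t ht => Submodule.smul_mem _ _ (monomial_mem_lowerTerms ?_)
  obtain ⟨hts, ht⟩ := Finset.mem_erase.mp ht
  exact lt_of_le_of_ne (hmax t ht) (lexExponent_injective.ne hts)

end HasLeadingExponent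

namespace HasDegree

variable {d d' : D} {γ γ' : ℤ ×ₗ ℤ}

theorem ne_zero (hD : IsQDivisionRing k D q x y) (h : HasDegree k x y d γ) : d ≠ 0 := by
  obtain ⟨s, t, m, n, -, -, hs, -, e, -⟩ := h
  rintro rfl
  exact hs.ne_zero hD (by rw [← e, mul_zero])

theorem mul (hq : q ≠ 0) (hD : IsQDivisionRing k D q x y) (h : HasDegree k x y d γ)
    (h' : HasDegree k x y d' γ') : HasDegree k x y (d * d') (γ + γ') := by
  obtain ⟨s, t, m, n, hsA, htA, hs, ht, e, hγ⟩ := h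
  obtain ⟨s', t', m', n', hsA', htA', hs', ht', e', hγ'⟩ := h'
  obtain ⟨u, u', huA, huA', hu0', hu⟩ := hD.exists_ore s (ht'.ne_zero hD)
  have hu0 : u ≠ 0 := by
    rintro rfl
    exact mul_ne_zero hu0' (hs.ne_zero hD) (by rw [hu, zero_mul])
  obtain ⟨l, hl⟩ := HasLeadingExponent.exists_of_mem_adjoin hD huA hu0
  obtain ⟨l', hl'⟩ := HasLeadingExponent.exists_of_mem_adjoin hD huA' hu0'
  refine ⟨u * s', u' * t, l + m', l' + n, mul_mem huA hsA', mul_mem huA' htA,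
    hl.mul hq hD.qcommute hs', hl'.mul hq hD.qcommute ht, ?_, ?_⟩
  · rw [← e', ← mul_assoc u, ← hu, ← e]
    simp only [mul_assoc]
  · have key := (hl'.mul hq hD.qcommute hs).unique hD (hu ▸ hl.mul hq hD.qcommute ht')
    simp only [lexExponent_add] at key ⊢
    calc γ + γ' + (lexExponent l' + lexExponent n)
        = lexExponent l' + (γ + lexExponent n) + γ' := by abel
      _ = lexExponent l + (γ' + lexExponent n') := by rw [hγ, key]; abel
      _ = lexExponent l + lexExponent m' := by rw [hγ']

theorem inv (hD : IsQDivisionRing k D q x y) (h : HasDegree k x y d γ) :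
    HasDegree k x y d⁻¹ (-γ) := by
  have hd := h.ne_zero hD
  obtain ⟨s, t, m, n, hsA, htA, hs, ht, e, hγ⟩ := h
  exact ⟨t, s, n, m, htA, hsA, ht, hs, by rw [← e, mul_inv_cancel_right₀ hd],
    by rw [← hγ, neg_add_cancel_left]⟩

theorem add_lower (hq : q ≠ 0) (hD : IsQDivisionRing k D q x y) (h : HasDegree k x y d γ)
    (h' : HasDegree k x y d' γ') (hlt : γ' < γ) : HasDegree k x y (d + d') γ := by
  obtain ⟨s, t, m, n, hsA, htA, hs, ht, e, hγ⟩ := h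
  obtain ⟨s', t', m', n', hsA', htA', hs', ht', e', hγ'⟩ := h'
  obtain ⟨u, u', huA, huA', hu0', hu⟩ := hD.exists_ore t (ht'.ne_zero hD)
  have hu0 : u ≠ 0 := by
    rintro rfl
    exact mul_ne_zero hu0' (ht.ne_zero hD) (by rw [hu, zero_mul])
  obtain ⟨l, hl⟩ := HasLeadingExponent.exists_of_mem_adjoin hD huA hu0
  obtain ⟨l', hl'⟩ := HasLeadingExponent.exists_of_mem_adjoin hD huA' hu0'
  have key := (hl'.mul hq hD.qcommute ht).unique hD (hu ▸ hl.mul hq hD.qcommute ht')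
  simp only [lexExponent_add] at key
  refine ⟨u' * s + u * s', u' * t, l' + m, l' + n,
    add_mem (mul_mem huA' hsA) (mul_mem huA hsA'), mul_mem huA' htA,
    (hl'.mul hq hD.qcommute hs).add_lower ((hl.mul hq hD.qcommute hs').mem_lowerTerms ?_),
    hl'.mul hq hD.qcommute ht, ?_, ?_⟩
  · simp only [lexExponent_add]
    calc lexExponent l + lexExponent m' = γ' + (lexExponent l' + lexExponent n) := by
          rw [← hγ', key]; abel
      _ < γ + (lexExponent l' + lexExponent n) := add_lt_add_left hlt _
      _ = lexExponent l' + lexExponent m := by rw [← hγ]; abel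
  · rw [mul_add, ← e, ← e', ← mul_assoc u, ← hu]
    simp only [mul_assoc]
  · simp only [lexExponent_add, ← hγ]
    abel

variable (k x y) in
theorem monomial (s : ℕ × ℕ) : HasDegree k x y (y ^ s.1 * x ^ s.2) (lexExponent s) := by
  refine ⟨_, 1, s, 0, mul_mem (pow_mem (Algebra.subset_adjoin (by simp)) _)
    (pow_mem (Algebra.subset_adjoin (by simp)) _), one_mem _, .monomial k x y s, ?_, one_mul _, ?_⟩
  · simpa using HasLeadingExponent.monomial k x y 0
  · rw [← lexExponent_add, add_zero]

variable (k x y) in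
theorem scalar {c : k} (hc : c ≠ 0) : HasDegree k x y (algebraMap k D c) 0 := by
  refine ⟨_, 1, 0, 0, Subalgebra.algebraMap_mem _ c, one_mem _, ⟨c, hc, ?_⟩, ?_, one_mul _,
    zero_add _⟩
  · simp [Algebra.algebraMap_eq_smul_one]
  · simpa using HasLeadingExponent.monomial k x y 0

theorem smul (hq : q ≠ 0) (hD : IsQDivisionRing k D q x y) (h : HasDegree k x y d γ) {c : k}
    (hc : c ≠ 0) : HasDegree k x y (c • d) γ := by
  rw [Algebra.smul_def, ← zero_add γ]
  exact (scalar k x y hc).mul hq hD h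

theorem pow (hq : q ≠ 0) (hD : IsQDivisionRing k D q x y) (h : HasDegree k x y d γ) (n : ℕ) :
    HasDegree k x y (d ^ n) (n • γ) := by
  induction n with
  | zero => simpa using scalar k x y (one_ne_zero (α := k))
  | succ n ih => rw [pow_succ, succ_nsmul]; exact ih.mul hq hD h

theorem linearIndependent (hq : q ≠ 0) (hD : IsQDivisionRing k D q x y) {ι : Type*} {u : ι → D}
    {γ : ι → ℤ ×ₗ ℤ} (hu : ∀ i, HasDegree k x y (u i) (γ i)) (hγ : Function.Injective γ) :
    LinearIndependent k u := by
  classical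
  have key (c : ι → k) (s : Finset ι) (hs : s.Nonempty) (hc : ∀ i ∈ s, c i ≠ 0) :
      ∃ j ∈ s, HasDegree k x y (∑ i ∈ s, c i • u i) (γ j) := by
    induction s using Finset.induction_on_max_value γ with
    | empty => simp at hs
    | insert a s ha hmax ih =>
      have h := (hu a).smul hq hD (hc a (Finset.mem_insert_self a s))
      refine ⟨a, Finset.mem_insert_self a s, ?_⟩
      rw [Finset.sum_insert ha]
      rcases s.eq_empty_or_nonempty with rfl | hne
      · simpa using h
      · obtain ⟨j, hj, hdeg⟩ := ih hne fun i hi => hc i (Finset.mem_insert_of_mem hi)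
        refine h.add_lower hq hD hdeg (lt_of_le_of_ne (hmax j hj) (hγ.ne ?_))
        rintro rfl
        exact ha hj
  rw [linearIndependent_iff']
  intro s c hsum
  by_contra! hne
  obtain ⟨i, hi, hci⟩ := hne
  obtain ⟨j, -, hdeg⟩ := key c (s.filter fun i => c i ≠ 0)
    ⟨i, Finset.mem_filter.mpr ⟨hi, hci⟩⟩ fun i hi => (Finset.mem_filter.mp hi).2
  refine hdeg.ne_zero hD ?_
  rw [← hsum, Finset.sum_filter_of_ne]
  rintro i - h0 hc
  exact h0 (by rw [hc, zero_smul])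

end HasDegree

end Degree

section Extension

variable {k D : Type*} [Field k] [DivisionRing D] [Algebra k D] {q : k} {x y f g : D}

/-- The division subring generated over `k` by a set, as a subfield. -/
def divisionClosure (k : Type*) [Field k] {D : Type*} [DivisionRing D] [Algebra k D] (s : Set D) :
    Subfield D where
  carrier := {d | MemDivisionClosure k s d}
  mul_mem' := .mul
  one_mem' := by simpa using MemDivisionClosure.scalar (k := k) (s := s) 1
  add_mem' := .add
  zero_mem' := by simpa using MemDivisionClosure.scalar (k := k) (s := s) 0
  neg_mem' := .neg
  inv_mem' _ := .inv

theorem smul_mem_divisionClosure {s : Set D} (c : k) {d : D} (hd : d ∈ divisionClosure k s) :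
    c • d ∈ divisionClosure k s := by
  rw [Algebra.smul_def]
  exact mul_mem (MemDivisionClosure.scalar c) hd

theorem adjoin_le_divisionClosure {s : Set D} {d : D} (hd : d ∈ Algebra.adjoin k s) :
    d ∈ divisionClosure k s := by
  induction hd using Algebra.adjoin_induction with
  | mem d hd => exact .mem hd
  | algebraMap c => exact .scalar c
  | add _ _ _ _ h h' => exact add_mem h h'
  | mul _ _ _ _ h h' => exact mul_mem h h'

/-- The subalgebra of `D × D` that relates each polynomial in `x`, `y` to the same polynomial
in `f`, `g`. -/
def substitutionGraph (k : Type*) [Field k] {D : Type*} [DivisionRing D] [Algebra k D]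
    (x y f g : D) : Subalgebra k (D × D) :=
  Algebra.adjoin k {(x, f), (y, g)}

theorem exists_mem_substitutionGraph {r : D} (hr : r ∈ Algebra.adjoin k ({x, y} : Set D)) :
    ∃ r', (r, r') ∈ substitutionGraph k x y f g := by
  have h : (substitutionGraph k x y f g).map (AlgHom.fst k D D) = Algebra.adjoin k {x, y} := by
    rw [substitutionGraph, AlgHom.map_adjoin, Set.image_pair]
    rfl
  rw [← h] at hr
  obtain ⟨⟨r, r'⟩, hr, rfl⟩ := hr
  exact ⟨r', hr⟩

theorem mem_adjoin_of_mem_substitutionGraph {r : D × D} (hr : r ∈ substitutionGraph k x y f g) :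
    r.2 ∈ Algebra.adjoin k ({f, g} : Set D) := by
  have h : (substitutionGraph k x y f g).map (AlgHom.snd k D D) = Algebra.adjoin k {f, g} := by
    rw [substitutionGraph, AlgHom.map_adjoin, Set.image_pair]
    rfl
  rw [← h]
  exact ⟨r, hr, rfl⟩

theorem fst_eq_zero_iff_of_mem_substitutionGraph (hxy : x * y = q • (y * x))
    (hfg : f * g = q • (g * f))
    (hx : LinearIndependent k fun s : ℕ × ℕ => y ^ s.1 * x ^ s.2)
    (hf : LinearIndependent k fun s : ℕ × ℕ => g ^ s.1 * f ^ s.2) {r : D × D}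
    (hr : r ∈ substitutionGraph k x y f g) : r.1 = 0 ↔ r.2 = 0 := by
  have hspan := adjoin_le_span_monomials (x := (x, f)) (y := (y, g)) (q := q)
    (Prod.ext hxy hfg) hr
  obtain ⟨c, rfl⟩ := Finsupp.mem_span_range_iff_exists_finsupp.mp hspan
  have h1 : (c.sum fun s e => e • ((y, g) ^ s.1 * (x, f) ^ s.2 : D × D)).1 =
      Finsupp.linearCombination k (fun s : ℕ × ℕ => y ^ s.1 * x ^ s.2) c := by
    simp [Finsupp.sum, Finsupp.linearCombination_apply, Prod.fst_sum]
  have h2 : (c.sum fun s e => e • ((y, g) ^ s.1 * (x, f) ^ s.2 : D × D)).2 =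
      Finsupp.linearCombination k (fun s : ℕ × ℕ => g ^ s.1 * f ^ s.2) c := by
    simp [Finsupp.sum, Finsupp.linearCombination_apply, Prod.snd_sum]
  rw [h1, h2]
  constructor <;> intro h
  · rw [(linearIndependent_iff.mp hx) c h, map_zero]
  · rw [(linearIndependent_iff.mp hf) c h, map_zero]

/-- A pair `f`, `g` that satisfies the same commutation rule as `x`, `y` and has linearly
independent monomials defines an endomorphism of the `q`-division ring. -/
theorem IsQDivisionRing.exists_algHom (hD : IsQDivisionRing k D q x y)
    (hfg : f * g = q • (g * f))
    (hf : LinearIndependent k fun s : ℕ × ℕ => g ^ s.1 * f ^ s.2) :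
    ∃ F : D →ₐ[k] D, Set.range F = {d | MemDivisionClosure k ({f, g} : Set D) d} := by
  set B := substitutionGraph k x y f g with hB
  have hzero {r r' : D} (h : (r, r') ∈ B) : r = 0 ↔ r' = 0 :=
    fst_eq_zero_iff_of_mem_substitutionGraph hD.qcommute hfg hD.monomials_linearIndependent hf h
  have hsnd {r r₁ r₂ : D} (h₁ : (r, r₁) ∈ B) (h₂ : (r, r₂) ∈ B) : r₁ = r₂ := by
    have h := B.sub_mem h₁ h₂
    rw [Prod.mk_sub_mk, sub_self] at h
    exact sub_eq_zero.mp ((hzero h).mp rfl)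
  let Rel (d d' : D) : Prop :=
    ∃ s s' t t' : D, (s, s') ∈ B ∧ (t, t') ∈ B ∧ t ≠ 0 ∧ t * d = s ∧ t' * d' = s'
  have hex (d : D) : ∃ d', Rel d d' := by
    obtain ⟨s, t, hs, ht, ht0, rfl⟩ := hD.exists_frac d
    obtain ⟨s', hs'⟩ := exists_mem_substitutionGraph (f := f) (g := g) hs
    obtain ⟨t', ht'⟩ := exists_mem_substitutionGraph (f := f) (g := g) ht
    exact ⟨t'⁻¹ * s', s, s', t, t', hs', ht', ht0, mul_inv_cancel_left₀ ht0 s,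
      mul_inv_cancel_left₀ (mt (hzero ht').mpr ht0) s'⟩
  have hore {s s' t t' : D} (hs : (s, s') ∈ B) (ht : (t, t') ∈ B) (ht0 : t ≠ 0) :
      ∃ u u' v v' : D, (u, u') ∈ B ∧ (v, v') ∈ B ∧ v ≠ 0 ∧ v * s = u * t ∧ v' * s' = u' * t' := by
    obtain ⟨u, v, hu, hv, hv0, e⟩ := hD.exists_ore s ht0
    obtain ⟨u', hu'⟩ := exists_mem_substitutionGraph (f := f) (g := g) hu
    obtain ⟨v', hv'⟩ := exists_mem_substitutionGraph (f := f) (g := g) hv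
    exact ⟨u, u', v, v', hu', hv', hv0, e, hsnd (B.mul_mem hv' hs) (e ▸ B.mul_mem hu' ht)⟩
  have hadd {d d' e e' : D} (hd : Rel d d') (he : Rel e e') : Rel (d + e) (d' + e') := by
    obtain ⟨s, s', t, t', hs, ht, ht0, rfl, rfl⟩ := hd
    obtain ⟨s₁, s₁', t₁, t₁', hs₁, ht₁, ht₁0, rfl, rfl⟩ := he
    obtain ⟨u, u', v, v', hu, hv, hv0, h, h'⟩ := hore ht ht₁ ht₁0
    refine ⟨v * (t * d) + u * (t₁ * e), v' * (t' * d') + u' * (t₁' * e'), v * t, v' * t',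
      B.add_mem (B.mul_mem hv hs) (B.mul_mem hu hs₁),
      B.mul_mem hv ht, mul_ne_zero hv0 ht0, ?_, ?_⟩
    · rw [mul_add, ← mul_assoc u, ← h]
      simp only [mul_assoc]
    · rw [mul_add, ← mul_assoc u', ← h']
      simp only [mul_assoc]
  have hmul {d d' e e' : D} (hd : Rel d d') (he : Rel e e') : Rel (d * e) (d' * e') := by
    obtain ⟨s, s', t, t', hs, ht, ht0, h₁, h₁'⟩ := hd
    obtain ⟨s₁, s₁', t₁, t₁', hs₁, ht₁, ht₁0, rfl, rfl⟩ := he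
    obtain ⟨u, u', v, v', hu, hv, hv0, h, h'⟩ := hore hs ht₁ ht₁0
    refine ⟨u * (t₁ * e), u' * (t₁' * e'), v * t, v' * t', B.mul_mem hu hs₁, B.mul_mem hv ht,
      mul_ne_zero hv0 ht0, ?_, ?_⟩
    · rw [← mul_assoc u, ← h, ← h₁]
      simp only [mul_assoc]
    · rw [← mul_assoc u', ← h', ← h₁']
      simp only [mul_assoc]
  have hscalar (c : k) : Rel (algebraMap k D c) (algebraMap k D c) :=
    ⟨_, _, 1, 1, B.algebraMap_mem c, B.one_mem, one_ne_zero, one_mul _, one_mul _⟩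
  have hneg {d d' : D} (hd : Rel d d') : Rel (-d) (-d') := by
    simpa using hmul (hscalar (-1)) hd
  have huniq0 {d' : D} (hd : Rel 0 d') : d' = 0 := by
    obtain ⟨s, s', t, t', hs, ht, ht0, e, e'⟩ := hd
    rw [mul_zero] at e
    rw [(hzero hs).mp e.symm] at e'
    exact (mul_eq_zero.mp e').resolve_left (mt (hzero ht).mpr ht0)
  have huniq {d d₁ d₂ : D} (h₁ : Rel d d₁) (h₂ : Rel d d₂) : d₁ = d₂ := by
    have h := hadd h₁ (hneg h₂)
    rw [add_neg_cancel] at h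
    rw [← sub_eq_zero, sub_eq_add_neg]
    exact huniq0 h
  choose F hF using hex
  let Φ : D →ₐ[k] D :=
    { toFun := F
      map_one' := huniq (hF 1) (by simpa using hscalar 1)
      map_mul' := fun d e => huniq (hF _) (hmul (hF d) (hF e))
      map_zero' := huniq0 (hF 0)
      map_add' := fun d e => huniq (hF _) (hadd (hF d) (hF e))
      commutes' := fun c => huniq (hF _) (hscalar c) }
  have hgen {d d' : D} (hd : (d, d') ∈ B) : Φ d = d' :=
    huniq (hF d) ⟨d, d', 1, 1, hd, B.one_mem, one_ne_zero, one_mul _, one_mul _⟩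
  refine ⟨Φ, Set.Subset.antisymm ?_ ?_⟩
  · rintro _ ⟨d, rfl⟩
    obtain ⟨s, s', t, t', hs, ht, ht0, -, e⟩ := hF d
    have hd : Φ d = t'⁻¹ * s' := by
      rw [← e, inv_mul_cancel_left₀ (mt (hzero ht).mpr ht0)]
      rfl
    rw [hd]
    exact .mul (.inv (adjoin_le_divisionClosure (mem_adjoin_of_mem_substitutionGraph ht)))
      (adjoin_le_divisionClosure (mem_adjoin_of_mem_substitutionGraph hs))
  · intro d hd
    induction hd with
    | mem h =>
      obtain rfl | rfl := h
      · exact ⟨x, hgen (Algebra.subset_adjoin (by simp))⟩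
      · exact ⟨y, hgen (Algebra.subset_adjoin (by simp))⟩
    | scalar c => exact ⟨algebraMap k D c, Φ.commutes c⟩
    | add _ _ h h' =>
      obtain ⟨a, rfl⟩ := h
      obtain ⟨b, rfl⟩ := h'
      exact ⟨a + b, map_add Φ a b⟩
    | neg _ h =>
      obtain ⟨a, rfl⟩ := h
      exact ⟨-a, map_neg Φ a⟩
    | mul _ _ h h' =>
      obtain ⟨a, rfl⟩ := h
      obtain ⟨b, rfl⟩ := h'
      exact ⟨a * b, map_mul Φ a b⟩
    | inv _ h =>
      obtain ⟨a, rfl⟩ := h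
      exact ⟨a⁻¹, map_inv₀ Φ a⟩

end Extension

section Generation

variable {k D : Type*} [Field k] [DivisionRing D] [Algebra k D] {h p w v q : k}
  {x y a a' b b' t₁ t₂ f g g' : D}

/-- A division subring containing `f` and `g` also contains `t₁` and `g'`, and `f`, `g` satisfy the
same commutation rule as `x`, `y`. -/
theorem EigenRelations.mem_of_mem (H : EigenRelations h p w v a a' b b' t₁ t₂) (ha : a ≠ 0)
    (ha' : a' ≠ 0) (h3 : (3 : k) ≠ 0) (hp : h * p = 1) (hwv : w * v = 1) (hs : w + v + 1 = 0)
    (hg : g = a⁻¹ * b) (hg' : g' = a'⁻¹ * b') (hg0 : g ≠ 0)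
    (hf : f = t₂ - v • (t₁ * g) + ((v - w) * p) • (v • (g * g) + h ^ 2 • g⁻¹))
    (hf0 : f ≠ 0) (hP : h ^ 2 • (g * g) + g⁻¹ ≠ 0) (E : Subfield D)
    (hE : ∀ (c : k), ∀ d ∈ E, c • d ∈ E) (hfE : f ∈ E) (hgE : g ∈ E) :
    f * g = h ^ 2 • (g * f) ∧ t₁ ∈ E ∧ g' ∈ E := by
  have e₁ := H.sub_mul_eq ha ha' h3 hp hwv hs hg hg' hg0 hf
  have e₂ := H.qcommute ha ha' h3 hp hwv hs hg hg'
  have e₃ := H.t₁_mul ha ha' h3 hp hwv hs hg hg'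
  have hg'n : g' = g' - v • g + v • g := by abel
  have hmn : (g' - w • g) - (g' - v • g) = (v - w) • g := by module
  have hm : g' - w • g = (g' - v • g) + (v - w) • g := by module
  have hvw : v - w ≠ 0 := by
    intro h0
    apply h3
    grind
  have hh : h ≠ 0 := left_ne_zero_of_mul (hp ▸ one_ne_zero)
  set m := g' - w • g
  set n := g' - v • g
  set P := ((v - w) * h) • (h ^ 2 • (g * g) + g⁻¹) with hPdef
  rw [← smul_mul_assoc, ← hPdef] at e₁
  have hP0 : P ≠ 0 := smul_ne_zero (mul_ne_zero hvw hh) hP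
  have hn : n ≠ 0 := by
    intro h0
    rw [h0, mul_zero, eq_comm, mul_eq_zero] at e₁
    rw [h0, e₁.resolve_left hP0, sub_zero, eq_comm] at hmn
    exact smul_ne_zero hvw hg0 hmn
  have hm0 : m ≠ 0 := by
    intro h0
    rw [h0, mul_zero] at e₁
    exact mul_ne_zero hf0 hn e₁
  have hr : m * n⁻¹ = P⁻¹ * f := by
    rw [eq_inv_mul_iff_mul_eq₀ hP0, ← mul_assoc, ← e₁, mul_inv_cancel_right₀ hn]
  have hPE : P ∈ E := hE _ _ (add_mem (hE _ _ (mul_mem hgE hgE)) (inv_mem hgE))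
  have hrE : m * n⁻¹ ∈ E := hr ▸ mul_mem (inv_mem hPE) hfE
  have hrn : (m * n⁻¹ - 1) * n = (v - w) • g := by
    rw [sub_mul, inv_mul_cancel_right₀ hn, one_mul, hmn]
  have hr1 : m * n⁻¹ - 1 ≠ 0 := by
    intro h0
    rw [h0, zero_mul, eq_comm] at hrn
    exact smul_ne_zero hvw hg0 hrn
  have hnE : n ∈ E := by
    rw [← inv_mul_cancel_left₀ hr1 n, hrn]
    exact mul_mem (inv_mem (sub_mem hrE (one_mem E))) (hE _ _ hgE)
  have hg'E : g' ∈ E := hg'n ▸ add_mem hnE (hE _ _ hgE)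
  have hmE : m ∈ E := hm ▸ add_mem hnE (hE _ _ hgE)
  refine ⟨?_, ?_, hg'E⟩
  · have hf : f = P * (m * n⁻¹) := by rw [hr, mul_inv_cancel_left₀ hP0]
    have hPg : P * g = g * P := by
      rw [hPdef]
      simp only [smul_mul_assoc, mul_smul_comm, add_mul, mul_add, mul_assoc, mul_inv_cancel₀ hg0,
        inv_mul_cancel₀ hg0]
    have hnm : n⁻¹ * m = h ^ 2 • (m * n⁻¹) := by
      rw [inv_mul_eq_iff_eq_mul₀ hn, mul_smul_comm, ← mul_assoc, ← smul_mul_assoc, ← e₂,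
        mul_inv_cancel_right₀ hn]
    have hrg : m * n⁻¹ * g = h ^ 2 • (g * (m * n⁻¹)) := by
      have hg : g = (v - w)⁻¹ • (m - n) := by rw [hmn, inv_smul_smul₀ hvw]
      rw [hg]
      simp only [mul_smul_comm, smul_mul_assoc, sub_mul, mul_sub, ← mul_assoc n]
      have hnm' : h ^ 2 • (n * m * n⁻¹) = m := by
        rw [← smul_mul_assoc, ← e₂, mul_inv_cancel_right₀ hn]
      rw [mul_assoc m, hnm, inv_mul_cancel_right₀ hn, smul_comm (h ^ 2), smul_sub (h ^ 2),
        hnm', mul_smul_comm]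
    rw [hf, mul_assoc, hrg, mul_smul_comm, ← mul_assoc P, hPg, mul_assoc]
  · rw [← mul_inv_cancel_right₀ (mul_ne_zero hm0 hn) t₁, e₃]
    have h9 : (9 : D) ∈ E := ofNat_mem E 9
    exact mul_mem (hE _ _ (add_mem h9 (mul_mem (mul_mem hgE (sub_mem (hE _ _ hgE) (hE _ _ hg'E)))
      (add_mem (hE _ _ hg'E) (hE _ _ hgE))))) (inv_mem (mul_mem hmE hnE))

/-- If the coefficients of all products of `t₁`, `a`, `a'` lie in a division subring `E`, then
`D` is spanned by `1`, `a`, `a'` over `E`. -/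
theorem EigenRelations.exists_decomposition (H : EigenRelations h p w v a a' b b' t₁ t₂)
    (ha : a ≠ 0) (ha' : a' ≠ 0) (h3 : (3 : k) ≠ 0) (hD : IsQDivisionRing k D q x y)
    (hx : (3 : k) • x = t₁ + a + a') (hy : (3 : k) • y = t₁ + v • a + w • a')
    (hg : g = a⁻¹ * b) (hg' : g' = a'⁻¹ * b')
    (E : Subfield D) (hE : ∀ (c : k), ∀ d ∈ E, c • d ∈ E)
    (hgE : g ∈ E) (hg'E : g' ∈ E) (ht₁E : t₁ ∈ E) (d : D) :
    ∃ e₀ ∈ E, ∃ e₁ ∈ E, ∃ e₂ ∈ E, d = e₀ + a * e₁ + a' * e₂ := by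
  let _ : Module (E : Type _)ᵐᵒᵖ D := Module.compHom D E.subtype.op
  have hsmul (e : D) (he : e ∈ E) (r : D) : MulOpposite.op (⟨e, he⟩ : E) • r = r * e := rfl
  have hb : b = a * g := by rw [hg, mul_inv_cancel_left₀ ha]
  have hb' : b' = a' * g' := by rw [hg', mul_inv_cancel_left₀ ha']
  let left (r : D) : D →ₗ[(E : Type _)ᵐᵒᵖ] D :=
    { toFun := fun s => r * s
      map_add' := mul_add r
      map_smul' := fun e s => (mul_assoc r s _).symm }
  let L : Submodule (E : Type _)ᵐᵒᵖ D := Submodule.span _ {1, a, a'}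
  have hL (r : D) (hr : r ∈ ({1, a, a'} : Set D)) (e : D) (he : e ∈ E) : r * e ∈ L :=
    L.smul_mem (MulOpposite.op ⟨e, he⟩) (Submodule.subset_span hr)
  have hL1 (e : D) (he : e ∈ E) : e ∈ L := by simpa using hL 1 (by simp) e he
  have hLa := hL a (by simp)
  have hLa' := hL a' (by simp)
  have hLk (c : k) (r : D) (hr : r ∈ L) : c • r ∈ L := by
    have := L.smul_mem (MulOpposite.op ⟨_, hE c 1 (one_mem E)⟩) hr
    rwa [hsmul, mul_smul_comm, mul_one] at this
  have hstable (r : D) (h₁ : r ∈ L) (h₂ : r * a ∈ L) (h₃ : r * a' ∈ L) (s : D) (hs : s ∈ L) :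
      r * s ∈ L := by
    have hle : L ≤ L.comap (left r) := by
      refine Submodule.span_le.mpr ?_
      rintro _ (rfl | rfl | rfl)
      · simpa [left] using h₁
      · exact h₂
      · exact h₃
    exact hle hs
  have ht₂E : t₂ ∈ E := by
    rw [H.t₂_eq ha ha' hg hg']
    exact add_mem (neg_mem (mul_mem ht₁E (add_mem hgE hg'E)))
      (sub_mem (hE _ _ (mul_mem hgE hgE)) (hE _ _ (mul_mem hgE hg'E)))
  have hLt₁ := hstable t₁ (hL1 _ ht₁E)
    (by
      rw [H.a_mul_t₁, hb, ← mul_smul_comm]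
      exact sub_mem (hLa _ ht₁E) (hLa _ (hE _ _ hgE)))
    (by
      rw [H.a'_mul_t₁, hb', ← mul_smul_comm]
      exact sub_mem (hLa' _ ht₁E) (hLa' _ (hE _ _ hg'E)))
  have hLa_mul := hstable a (by simpa using hLa 1 (one_mem E))
    (by
      rw [H.a_mul_a, hb', ← mul_smul_comm]
      exact add_mem (hLa' _ ht₁E) (hLa' _ (hE _ _ hg'E)))
    (by
      rw [H.a_mul_a']
      exact hL1 _ (sub_mem (mul_mem ht₁E ht₁E) (hE _ _ ht₂E)))
  have hLa'_mul := hstable a' (by simpa using hLa' 1 (one_mem E))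
    (by
      rw [H.a'_mul_a]
      exact hL1 _ (sub_mem (mul_mem ht₁E ht₁E) (hE _ _ ht₂E)))
    (by
      rw [H.a'_mul_a', hb, ← mul_smul_comm]
      exact add_mem (hLa _ ht₁E) (hLa _ (hE _ _ hgE)))
  have hadj (r : D) (hr : r ∈ Algebra.adjoin k ({x, y} : Set D)) (s : D) (hs : s ∈ L) :
      r * s ∈ L := by
    induction hr using Algebra.adjoin_induction generalizing s with
    | mem r hr =>
      obtain rfl | rfl := hr
      · rw [← inv_smul_smul₀ h3 r, hx, smul_mul_assoc, add_mul, add_mul]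
        exact hLk _ _ (add_mem (add_mem (hLt₁ s hs) (hLa_mul s hs)) (hLa'_mul s hs))
      · rw [← inv_smul_smul₀ h3 r, hy, smul_mul_assoc, add_mul, add_mul, smul_mul_assoc,
          smul_mul_assoc]
        exact hLk _ _ (add_mem (add_mem (hLt₁ s hs) (hLk _ _ (hLa_mul s hs)))
          (hLk _ _ (hLa'_mul s hs)))
    | algebraMap c =>
      rw [← Algebra.smul_def]
      exact hLk c s hs
    | add r r' _ _ hr hr' =>
      rw [add_mul]
      exact add_mem (hr s hs) (hr' s hs)
    | mul r r' _ _ hr hr' =>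
      rw [mul_assoc]
      exact hr _ (hr' s hs)
  have : FiniteDimensional (E : Type _)ᵐᵒᵖ L :=
    FiniteDimensional.span_of_finite _ (Set.toFinite {1, a, a'})
  have hd : d ∈ L := by
    obtain ⟨s, t, hs, ht, ht0, rfl⟩ := hD.exists_frac d
    let T : L →ₗ[(E : Type _)ᵐᵒᵖ] L := (left t).restrict (hadj t ht)
    have hT : Function.Injective T := fun r r' hr =>
      Subtype.ext (mul_left_cancel₀ ht0 (congrArg Subtype.val hr))
    obtain ⟨r, hr⟩ := LinearMap.injective_iff_surjective.mp hT
      ⟨s, by simpa using hadj s hs 1 (hL1 1 (one_mem E))⟩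
    have hrs : t * r = s := congrArg Subtype.val hr
    rw [← hrs, inv_mul_cancel_left₀ ht0]
    exact r.2
  obtain ⟨e₀, e₁, e₂, rfl⟩ := Submodule.mem_span_triple.mp hd
  refine ⟨_, e₀.unop.2, _, e₁.unop.2, _, e₂.unop.2, ?_⟩
  rw [← one_mul (e₀.unop : D)]
  rfl

end Generation

section FixedRing

variable {k D : Type*} [Field k] [DivisionRing D] [Algebra k D] {h p w v q : k} {x y f g : D}

theorem map_cyclicEigenvector {X Y : D} {σ : D ≃ₐ[k] D} (hwv : w * v = 1) (hvv : v * v = w)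
    (hx : σ x = y) (hy : σ y = h • (Y * X)) (hz : σ (h • (Y * X)) = x) :
    σ (cyclicEigenvector h w v x y X Y) = v • cyclicEigenvector h w v x y X Y := by
  have hvy : v • w • y = y := by rw [smul_smul, mul_comm, hwv, one_smul]
  rw [cyclicEigenvector, map_add, map_add, map_smul, map_smul, hx, hy, hz, smul_add, smul_add,
    hvy, smul_smul v v, hvv]
  abel

theorem IsQDivisionRing.qTorusRules (hD : IsQDivisionRing k D q x y) (hh : h ^ 2 = q)
    (hp : h * p = 1) : QTorusRules h p x x⁻¹ y y⁻¹ := by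
  have hx := hD.x_ne_zero
  have hy := hD.y_ne_zero
  have hph : p ^ 2 * h ^ 2 = 1 := by rw [← mul_pow, mul_comm, hp, one_pow]
  have e : x * y = h ^ 2 • (y * x) := by rw [hh, hD.qcommute]
  have e' : y * x = p ^ 2 • (x * y) := by rw [e, smul_smul, hph, one_smul]
  have hXy : x⁻¹ * y = p ^ 2 • (y * x⁻¹) := by
    rw [inv_mul_eq_iff_eq_mul₀ hx, mul_smul_comm, ← mul_assoc, ← smul_mul_assoc, ← e',
      mul_inv_cancel_right₀ hx]
  refine ⟨hp, mul_inv_cancel₀ hx, inv_mul_cancel₀ hx, mul_inv_cancel₀ hy, inv_mul_cancel₀ hy, e,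
    ?_, hXy, ?_⟩
  · rw [eq_comm, ← mul_inv_eq_iff_eq_mul₀ (inv_ne_zero hy), inv_inv, smul_mul_assoc, mul_assoc, e,
      mul_smul_comm, smul_smul, hph, one_smul, inv_mul_cancel_left₀ hy]
  · rw [eq_comm, ← mul_inv_eq_iff_eq_mul₀ (inv_ne_zero hy), inv_inv, smul_mul_assoc, mul_assoc,
      hXy, mul_smul_comm, smul_smul, mul_comm, hph, one_smul, inv_mul_cancel_left₀ hy]

namespace HasDegree

variable (k x y) in
theorem of_x : HasDegree k x y x (toLex (1, 0)) := by
  simpa [lexExponent] using HasDegree.monomial k x y (0, 1)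

variable (k x y) in
theorem of_y : HasDegree k x y y (toLex (0, 1)) := by
  simpa [lexExponent] using HasDegree.monomial k x y (1, 0)

theorem of_cyclicEigenvector (hq : q ≠ 0) (hD : IsQDivisionRing k D q x y)
    (hh : h ≠ 0) (hw : w ≠ 0) (hv : v ≠ 0) :
    HasDegree k x y (cyclicEigenvector h w v x y x⁻¹ y⁻¹) (toLex (1, 0)) := by
  have hx := HasDegree.of_x k x y
  have hy := HasDegree.of_y k x y
  exact (hx.add_lower hq hD (hy.smul hq hD hw) (by decide)).add_lower hq hD
    ((((hy.inv hD).mul hq hD (hx.inv hD)).smul hq hD hh).smul hq hD hv) (by decide)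

theorem of_cyclicEigenvector_inv (hq : q ≠ 0) (hD : IsQDivisionRing k D q x y)
    (hh : h ≠ 0) (hw : w ≠ 0) (hv : v ≠ 0) :
    HasDegree k x y (cyclicEigenvector h w v x⁻¹ y⁻¹ x y) (toLex (1, 1)) := by
  have hx := HasDegree.of_x k x y
  have hy := HasDegree.of_y k x y
  rw [cyclicEigenvector, add_comm, add_comm x⁻¹, ← add_assoc]
  exact ((((hy.mul hq hD hx).smul hq hD hh).smul hq hD hv).add_lower hq hD
    ((hy.inv hD).smul hq hD hw) (by decide)).add_lower hq hD (hx.inv hD) (by decide)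

end HasDegree

/-- `f` as a sum of `a⁻¹ r`, where `a t₂ - v t₁ b` is a multiple of `r`, and multiples of `g ^ 2`
and `g⁻¹`. -/
theorem EigenRelations.eq_inv_mul_add {a a' b b' t₁ t₂ r : D}
    (H : EigenRelations h p w v a a' b b' t₁ t₂) (ha : a ≠ 0)
    (hg : g = a⁻¹ * b) (hr : a * t₂ - v • (t₁ * b) = (h * (w - v)) • r)
    (hf : f = t₂ - v • (t₁ * g) + ((v - w) * p) • (v • (g * g) + h ^ 2 • g⁻¹)) :
    f = (h * (w - v)) • (a⁻¹ * r) +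
      ((v * (v - w) * h) • (g * g) + ((v - w) * p * h ^ 2) • g⁻¹) := by
  have hb : b = a * g := by rw [hg, mul_inv_cancel_left₀ ha]
  have e := H.a_mul_t₁
  rw [hb] at hr e
  rw [← mul_assoc, e] at hr
  rw [← mul_smul_comm, ← hr, hf]
  have e' : a⁻¹ * (a * t₂ - v • ((a * t₁ - ((w - v) * (h - p)) • (a * g)) * g)) =
      t₂ - v • (t₁ * g) + (v * ((w - v) * (h - p))) • (g * g) := by
    simp only [mul_sub, sub_mul, smul_mul_assoc, mul_smul_comm, mul_assoc,
      inv_mul_cancel_left₀ ha]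
    module
  rw [e']
  module

theorem IsQDivisionRing.hasDegree_generators (hq : q ≠ 0) (hD : IsQDivisionRing k D q x y)
    (hh : h ^ 2 = q) (hp : h * p = 1) (hwv : w * v = 1) (hs : w + v + 1 = 0) (hvw : v - w ≠ 0)
    (hg : g = (cyclicEigenvector h w v x y x⁻¹ y⁻¹)⁻¹ * cyclicEigenvector h w v x⁻¹ y⁻¹ x y)
    (hf : f = cyclicEigenvector h 1 1 x⁻¹ y⁻¹ x y -
      v • (cyclicEigenvector h 1 1 x y x⁻¹ y⁻¹ * g) +
      ((v - w) * p) • (v • (g * g) + h ^ 2 • g⁻¹)) :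
    HasDegree k x y g (toLex (0, 1)) ∧ HasDegree k x y f (toLex (1, 1)) := by
  have hh0 : h ≠ 0 := left_ne_zero_of_mul (hp ▸ one_ne_zero)
  have hp0 : p ≠ 0 := right_ne_zero_of_mul (hp ▸ one_ne_zero)
  have hw0 : w ≠ 0 := left_ne_zero_of_mul (hwv ▸ one_ne_zero)
  have hv0 : v ≠ 0 := right_ne_zero_of_mul (hwv ▸ one_ne_zero)
  have hwv0 : w - v ≠ 0 := sub_ne_zero.mpr (sub_ne_zero.mp hvw).symm
  have hx := HasDegree.of_x k x y
  have hy := HasDegree.of_y k x y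
  have ha := HasDegree.of_cyclicEigenvector hq hD hh0 hw0 hv0
  have hb := HasDegree.of_cyclicEigenvector_inv hq hD hh0 hw0 hv0
  have H := hD.qTorusRules hh hp
  have hgdeg : HasDegree k x y g (toLex (0, 1)) := hg ▸ (ha.inv hD).mul hq hD hb
  have hr : HasDegree k x y (p • (y * x⁻¹) + (w * h ^ 2) • (y⁻¹ * y⁻¹ * x⁻¹) +
      (v * h ^ 2) • (y * x * x)) (toLex (2, 1)) := by
    rw [add_comm]
    refine (((hy.mul hq hD hx).mul hq hD hx).smul hq hD
      (mul_ne_zero hv0 (pow_ne_zero 2 hh0))).add_lower hq hD (γ' := toLex (-1, 1)) ?_ (by decide)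
    exact ((hy.mul hq hD (hx.inv hD)).smul hq hD hp0).add_lower hq hD
      ((((hy.inv hD).mul hq hD (hy.inv hD)).mul hq hD (hx.inv hD)).smul hq hD
        (mul_ne_zero hw0 (pow_ne_zero 2 hh0))) (by decide)
  have hrest : HasDegree k x y ((v * (v - w) * h) • (g * g) + ((v - w) * p * h ^ 2) • g⁻¹)
      (toLex (0, 2)) :=
    ((hgdeg.mul hq hD hgdeg).smul hq hD (mul_ne_zero (mul_ne_zero hv0 hvw) hh0)).add_lower hq hD
      ((hgdeg.inv hD).smul hq hD (mul_ne_zero (mul_ne_zero hvw hp0) (pow_ne_zero 2 hh0)))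
      (by decide)
  refine ⟨hgdeg, ?_⟩
  rw [(H.eigenRelations hwv hs).eq_inv_mul_add (ha.ne_zero hD) hg (H.eigenvector_mul_sub hwv hs) hf]
  exact (((ha.inv hD).mul hq hD hr).smul hq hD (mul_ne_zero hh0 hwv0)).add_lower hq hD hrest
    (by decide)

theorem HasDegree.linearIndependent_monomials (hq : q ≠ 0) (hD : IsQDivisionRing k D q x y)
    (hg : HasDegree k x y g (toLex (0, 1))) (hf : HasDegree k x y f (toLex (1, 1))) :
    LinearIndependent k fun s : ℕ × ℕ => g ^ s.1 * f ^ s.2 := by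
  refine HasDegree.linearIndependent hq hD
    (fun s => (hg.pow hq hD s.1).mul hq hD (hf.pow hq hD s.2)) ?_
  rintro ⟨i, j⟩ ⟨i', j'⟩ e
  have e' : i • ((0 : ℤ), (1 : ℤ)) + j • ((1 : ℤ), (1 : ℤ)) = i' • (0, 1) + j' • (1, 1) := e
  simp only [Prod.smul_mk, Prod.mk_add_mk, Prod.mk.injEq, nsmul_eq_mul] at e'
  simp only [Prod.mk.injEq]
  lia

/-- The fixed ring of the cyclic automorphism, for elements written with scalar multiplication. -/
theorem IsQDivisionRing.divisionClosure_eq_fixed (hq : q ≠ 0) (hD : IsQDivisionRing k D q x y)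
    (h3 : (3 : k) ≠ 0)
    (hh : h ^ 2 = q) (hp : h * p = 1) (hwv : w * v = 1) (hs : w + v + 1 = 0)
    (hg : g = (cyclicEigenvector h w v x y x⁻¹ y⁻¹)⁻¹ * cyclicEigenvector h w v x⁻¹ y⁻¹ x y)
    (hf : f = cyclicEigenvector h 1 1 x⁻¹ y⁻¹ x y -
      v • (cyclicEigenvector h 1 1 x y x⁻¹ y⁻¹ * g) +
      ((v - w) * p) • (v • (g * g) + h ^ 2 • g⁻¹))
    (σ : D ≃ₐ[k] D) (hσx : σ x = y) (hσy : σ y = h • (y⁻¹ * x⁻¹)) :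
    {d | MemDivisionClosure k ({f, g} : Set D) d} = {d | σ d = d} ∧
    ∃ F : D →ₐ[k] D, Function.Injective F ∧ Set.range F = {d | σ d = d} := by
  have hh0 : h ≠ 0 := left_ne_zero_of_mul (hp ▸ one_ne_zero)
  have hw0 : w ≠ 0 := left_ne_zero_of_mul (hwv ▸ one_ne_zero)
  have hv0 : v ≠ 0 := right_ne_zero_of_mul (hwv ▸ one_ne_zero)
  have hvv : v * v = w := by grind
  have hww : w * w = v := by grind
  have hvw : v - w ≠ 0 := by
    intro h0
    apply h3
    grind
  obtain ⟨hgdeg, hfdeg⟩ := hD.hasDegree_generators hq hh hp hwv hs hvw hg hf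
  have H := (hD.qTorusRules hh hp).eigenRelations hwv hs
  have ha := (HasDegree.of_cyclicEigenvector hq hD hh0 hw0 hv0).ne_zero hD
  have ha' := (HasDegree.of_cyclicEigenvector hq hD hh0 hv0 hw0).ne_zero hD
  have hg0 := hgdeg.ne_zero hD
  have hP : h ^ 2 • (g * g) + g⁻¹ ≠ 0 :=
    (((hgdeg.mul hq hD hgdeg).smul hq hD (pow_ne_zero 2 hh0)).add_lower hq hD (hgdeg.inv hD)
      (by decide)).ne_zero hD
  have hE (c : k) (d : D) (hd : d ∈ divisionClosure k {f, g}) : c • d ∈ divisionClosure k {f, g} :=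
    smul_mem_divisionClosure c hd
  have hgE : g ∈ divisionClosure k {f, g} := MemDivisionClosure.mem (by simp)
  obtain ⟨hfg, ht₁E, hg'E⟩ := H.mem_of_mem ha ha' h3 hp hwv hs hg rfl hg0 hf
    (hfdeg.ne_zero hD) hP (divisionClosure k {f, g}) hE (MemDivisionClosure.mem (by simp)) hgE
  have hσz : σ (h • (y⁻¹ * x⁻¹)) = x := by
    rw [map_smul, map_mul, map_inv₀, map_inv₀, hσx, hσy, smul_inv₀, mul_inv_rev, inv_inv, inv_inv,
      smul_mul_assoc, smul_inv_smul₀ hh0, mul_inv_cancel_right₀ hD.y_ne_zero]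
  have hσX : σ x⁻¹ = y⁻¹ := by rw [map_inv₀, hσx]
  have hz : h • (y * x) = (h • (y⁻¹ * x⁻¹))⁻¹ := by
    rw [smul_inv₀, mul_inv_rev, inv_inv, inv_inv, eq_inv_smul_iff₀ hh0, smul_smul, ← pow_two, hh,
      hD.qcommute]
  have hσY : σ y⁻¹ = h • (y * x) := by rw [map_inv₀, hσy, hz]
  have hσZ : σ (h • (y * x)) = x⁻¹ := by rw [hz, map_inv₀, hσz]
  have hσa := map_cyclicEigenvector hwv hvv hσx hσy hσz
  have hσa' := map_cyclicEigenvector (mul_comm w v ▸ hwv) hww hσx hσy hσz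
  have hσb := map_cyclicEigenvector hwv hvv hσX hσY hσZ
  have hσt₁ := map_cyclicEigenvector (w := 1) (v := 1) (one_mul 1) (one_mul 1) hσx hσy hσz
  have hσt₂ := map_cyclicEigenvector (w := 1) (v := 1) (one_mul 1) (one_mul 1) hσX hσY hσZ
  rw [one_smul] at hσt₁ hσt₂
  have hσg : σ g = g := by
    rw [hg, map_mul, map_inv₀, hσa, hσb, smul_inv₀, smul_mul_smul_comm, inv_mul_cancel₀ hv0,
      one_smul]
  have hσf : σ f = f := by
    rw [hf]
    simp only [map_add, map_sub, map_smul, map_mul, map_inv₀, hσg, hσt₁, hσt₂]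
  have hfixed (d : D) (hd : MemDivisionClosure k {f, g} d) : σ d = d := by
    induction hd with
    | mem hd =>
      obtain rfl | rfl := hd
      · exact hσf
      · exact hσg
    | scalar c => exact σ.commutes c
    | add _ _ h₁ h₂ => rw [map_add, h₁, h₂]
    | neg _ h₁ => rw [map_neg, h₁]
    | mul _ _ h₁ h₂ => rw [map_mul, h₁, h₂]
    | inv _ h₁ => rw [map_inv₀, h₁]
  have heq : {d | MemDivisionClosure k ({f, g} : Set D) d} = {d | σ d = d} := by
    refine Set.Subset.antisymm hfixed fun d (hd : σ d = d) => ?_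
    obtain ⟨e₀, he₀, e₁, he₁, e₂, he₂, e⟩ := H.exists_decomposition ha ha' h3 hD
      (by simp only [cyclicEigenvector]; match_scalars <;> grind)
      (by simp only [cyclicEigenvector]; match_scalars <;> grind)
      hg rfl (divisionClosure k {f, g}) hE hgE hg'E ht₁E d
    have eσ := congrArg σ e
    rw [map_add, map_add, map_mul, map_mul, hσa, hσa', hfixed e₀ he₀, hfixed e₁ he₁,
      hfixed e₂ he₂, hd, smul_mul_assoc, smul_mul_assoc] at eσ
    have eσσ := congrArg σ eσ
    rw [map_add, map_add, map_smul, map_smul, map_mul, map_mul, hσa, hσa', hfixed e₀ he₀,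
      hfixed e₁ he₁, hfixed e₂ he₂, hd, smul_mul_assoc, smul_mul_assoc, smul_smul, smul_smul] at eσσ
    have h3d : (3 : k) • d = (3 : k) • e₀ := by
      rw [show (3 : k) • d = d + d + d by module]
      nth_rw 1 [e]
      nth_rw 1 [eσ]
      nth_rw 1 [eσσ]
      match_scalars <;> grind
    rw [smul_right_injective D h3 h3d]
    exact he₀
  obtain ⟨F, hF⟩ := hD.exists_algHom (hh ▸ hfg) (hgdeg.linearIndependent_monomials hq hD hfdeg)
  exact ⟨heq, F, F.toRingHom.injective, hF.trans heq⟩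

end FixedRing

/-- The division subring `k_q(f,g)` of `D` generated over `k` by `f` and `g` equals the fixed
ring `D^σ = {r ∈ D : σ(r) = r}`, and consequently `D^σ` is isomorphic to `D = k_q(x,y)` as a
`k`-algebra (for the same `q`): there is an injective `k`-algebra endomorphism of `D` whose
range is exactly `D^σ`. -/
theorem stmt11 (k : Type*) [Field k] [CharZero k] (q : k) (hq : q ≠ 0)
    (ω : k) (hω : IsPrimitiveRoot ω 3) (qh : k) (hqh : qh ^ 2 = q)
    (D : Type*) [DivisionRing D] [Algebra k D] (x y : D)
    (hD : IsQDivisionRing k D q x y)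
    (σ : D ≃ₐ[k] D) (hσx : σ x = y)
    (hσy : σ y = algebraMap k D qh * (y⁻¹ * x⁻¹)) :
    let Q : D := algebraMap k D q
    let Qh : D := algebraMap k D qh
    let W : D := algebraMap k D ω
    let θ₁ : D := x + y + Qh * (y⁻¹ * x⁻¹)
    let θ₂ : D := x⁻¹ + y⁻¹ + Qh * (y * x)
    let a : D := x + W * y + W ^ 2 * (Qh * (y⁻¹ * x⁻¹))
    let b : D := x⁻¹ + W * y⁻¹ + W ^ 2 * (Qh * (y * x))
    let g : D := a⁻¹ * b
    let f : D := θ₂ - W ^ 2 * (θ₁ * g) + (W ^ 2 - W) * Qh⁻¹ * (W ^ 2 * g ^ 2 + Qh ^ 2 * g⁻¹)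
    ({r : D | MemDivisionClosure k ({f, g} : Set D) r} = {r : D | σ r = r}) ∧
    ∃ F : D →ₐ[k] D, Function.Injective F ∧
      Set.range F = {r : D | σ r = r} := by
  intro Q Qh W θ₁ θ₂ a b g f
  have h3 : (3 : k) ≠ 0 := three_ne_zero
  have hqh0 : qh ≠ 0 := fun h0 => hq (by rw [← hqh, h0, zero_pow two_ne_zero])
  have hs : ω + ω ^ 2 + 1 = 0 := by
    have e := hω.geom_sum_eq_zero (by norm_num)
    simp only [Finset.sum_range_succ, Finset.sum_range_zero] at e
    linear_combination e
  have ha : a = cyclicEigenvector qh ω (ω ^ 2) x y x⁻¹ y⁻¹ := by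
    simp only [a, cyclicEigenvector, Algebra.smul_def, map_pow, W, Qh]
  have hb : b = cyclicEigenvector qh ω (ω ^ 2) x⁻¹ y⁻¹ x y := by
    simp only [b, cyclicEigenvector, Algebra.smul_def, map_pow, W, Qh]
  have hθ₁ : θ₁ = cyclicEigenvector qh 1 1 x y x⁻¹ y⁻¹ := by
    simp only [θ₁, cyclicEigenvector, Algebra.smul_def, map_one, one_mul, Qh]
  have hθ₂ : θ₂ = cyclicEigenvector qh 1 1 x⁻¹ y⁻¹ x y := by
    simp only [θ₂, cyclicEigenvector, Algebra.smul_def, map_one, one_mul, Qh]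
  refine hD.divisionClosure_eq_fixed hq h3 hqh (mul_inv_cancel₀ hqh0)
    (by rw [← pow_succ', hω.pow_eq_one]) hs (by rw [← ha, ← hb]) ?_ σ hσx
    (by rw [hσy, Algebra.smul_def])
  rw [← hθ₁, ← hθ₂]
  simp only [f, Algebra.smul_def, map_mul, map_sub, map_pow, map_inv₀, W, Qh, pow_two g]
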